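/- Let Z be a random vector in ℝ^d with law N(0, (1/d)·I_d), independent of X, and define V_w(λ) := E_X[ P( ‖Z‖₂ > ρ(ψ_w(X))/λ | X ) ]. Suppose there exist τ > 0 and C_τ < ∞ such that E_X[ (ρ(ψ_w(X))/√d)^{−τ} ] ≤ C_τ. Then for every λ ∈ (0,1) and every q ∈ (0,1): V_w(λ) ≤ C_τ·λ^{qτ} + exp( −1/(10·λ^{2(1−q)}) ). -/

import Mathlib

open MeasureTheory Metric Real
open scoped RealInnerProductSpace

noncomputable section

/-- Density of the Gaussian measure `N(0, σ²·I_d)` on `ℝ^d`. -/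
def gaussDensity (d : ℕ) (σ : ℝ) (v : EuclideanSpace ℝ (Fin d)) : ℝ :=
  (2 * π * σ ^ 2) ^ (-(d : ℝ) / 2) * Real.exp (-‖v‖ ^ 2 / (2 * σ ^ 2))

/-- The Gaussian measure `N(0, σ²·I_d)` on `ℝ^d`. -/
def gaussMeasure (d : ℕ) (σ : ℝ) : Measure (EuclideanSpace ℝ (Fin d)) :=
  volume.withDensity fun v => ENNReal.ofReal (gaussDensity d σ v)

/-- Normal cone `F_y` of the finite set `Y` at the point `y`. -/
def normalCone {d : ℕ} (Y : Finset (EuclideanSpace ℝ (Fin d)))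
    (y : EuclideanSpace ℝ (Fin d)) : Set (EuclideanSpace ℝ (Fin d)) :=
  {θ | ∀ y' ∈ Y, ⟪y', θ⟫ ≤ ⟪y, θ⟫}

/-- Internal cone radius `ρ(θ)`. -/
def coneRadius {d : ℕ} (Y : Finset (EuclideanSpace ℝ (Fin d)))
    (θ : EuclideanSpace ℝ (Fin d)) : ℝ :=
  sSup {r : ℝ | 0 < r ∧ ∀ u ∈ closedBall (0 : EuclideanSpace ℝ (Fin d)) 1,
    ∃ y ∈ Y, θ ∈ normalCone Y y ∧ θ + r • u ∈ normalCone Y y}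

/-- Uniform probability measure on the closed Euclidean unit ball of `ℝ^d`. -/
def uniformBall (d : ℕ) : Measure (EuclideanSpace ℝ (Fin d)) :=
  (volume (closedBall (0 : EuclideanSpace ℝ (Fin d)) 1))⁻¹ •
    volume.restrict (closedBall (0 : EuclideanSpace ℝ (Fin d)) 1)

/-- `p_0(y|θ) = P[θ + ρ(θ)·U ∈ F_y]` for `U` uniform on the closed unit ball. -/
def p0 {d : ℕ} (Y : Finset (EuclideanSpace ℝ (Fin d)))
    (y θ : EuclideanSpace ℝ (Fin d)) : ℝ :=
  (uniformBall d {u | θ + coneRadius Y θ • u ∈ normalCone Y y}).toReal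

lemma gaussMeasure_le_integral {d : ℕ} {σ : ℝ} {A : Set (EuclideanSpace ℝ (Fin d))}
    (hA : MeasurableSet A) {g : EuclideanSpace ℝ (Fin d) → ℝ} (hg : Integrable g)
    (hg0 : ∀ v, 0 ≤ g v) (hle : ∀ v ∈ A, gaussDensity d σ v ≤ g v) :
    gaussMeasure d σ A ≤ ENNReal.ofReal (∫ v, g v) := by
  rw [gaussMeasure, withDensity_apply _ hA,
    ofReal_integral_eq_lintegral_ofReal hg (Filter.Eventually.of_forall hg0)]
  calc ∫⁻ v in A, ENNReal.ofReal (gaussDensity d σ v)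
      ≤ ∫⁻ v in A, ENNReal.ofReal (g v) :=
        setLIntegral_mono' hA fun v hv => ENNReal.ofReal_le_ofReal (hle v hv)
    _ ≤ ∫⁻ v, ENNReal.ofReal (g v) := setLIntegral_le_lintegral _ _

lemma integrable_exp_neg_mul_norm_sq (d : ℕ) {b : ℝ} (hb : 0 < b) :
    Integrable fun v : EuclideanSpace ℝ (Fin d) => Real.exp (-b * ‖v‖ ^ 2) := by
  apply Integrable.of_integral_ne_zero
  rw [GaussianFourier.integral_rexp_neg_mul_sq_norm hb]
  positivity

lemma gaussDensity_inv_sqrt {d : ℕ} (hd : 1 ≤ d) (v : EuclideanSpace ℝ (Fin d)) :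
    gaussDensity d (√d)⁻¹ v =
      (2 * π / d) ^ (-(d : ℝ) / 2) * Real.exp (-(d / 2) * ‖v‖ ^ 2) := by
  have hd0 : (0 : ℝ) < d := by exact_mod_cast hd
  rw [gaussDensity, inv_pow, Real.sq_sqrt hd0.le]
  congr 2
  field_simp

/-- A Chernoff-type estimate: the density is dominated by a Gaussian of smaller rate `b`. -/
lemma gaussMeasure_le_chernoff {d : ℕ} (hd : 1 ≤ d) {A : Set (EuclideanSpace ℝ (Fin d))}
    (hA : MeasurableSet A) {b K : ℝ} (hb : 0 < b)
    (hK : ∀ v ∈ A, -(d / 2) * ‖v‖ ^ 2 ≤ K - b * ‖v‖ ^ 2) :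
    gaussMeasure d (√d)⁻¹ A ≤ ENNReal.ofReal (Real.exp K * (d / (2 * b)) ^ ((d : ℝ) / 2)) := by
  have hd0 : (0 : ℝ) < d := by exact_mod_cast hd
  refine (gaussMeasure_le_integral hA
    (g := fun v => ((2 * π / d) ^ (-(d : ℝ) / 2) * Real.exp K) * Real.exp (-b * ‖v‖ ^ 2))
    ((integrable_exp_neg_mul_norm_sq d hb).const_mul _) (fun v => by positivity)
    fun v hv => ?_).trans (ENNReal.ofReal_le_ofReal ?_)
  · rw [gaussDensity_inv_sqrt hd, mul_assoc, ← Real.exp_add]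
    gcongr
    linarith [hK v hv]
  · rw [integral_const_mul, GaussianFourier.integral_rexp_neg_mul_sq_norm hb,
      finrank_euclideanSpace_fin, neg_div, Real.rpow_neg (by positivity),
      ← Real.inv_rpow (by positivity), mul_comm _ (Real.exp K), mul_assoc,
      ← Real.mul_rpow (by positivity) (by positivity)]
    apply le_of_eq
    congr 2
    field_simp

lemma gaussMeasure_le_one {d : ℕ} (hd : 1 ≤ d) {A : Set (EuclideanSpace ℝ (Fin d))} :
    gaussMeasure d (√d)⁻¹ A ≤ 1 := by
  have hd0 : (0 : ℝ) < d := by exact_mod_cast hd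
  refine (measure_mono (Set.subset_univ A)).trans ((gaussMeasure_le_chernoff hd
    MeasurableSet.univ (b := d / 2) (K := 0) (by positivity) fun v _ => by linarith).trans ?_)
  rw [mul_div_cancel₀ _ (two_ne_zero' ℝ), div_self hd0.ne']
  simp

lemma measurableSet_lt_norm (d : ℕ) (r : ℝ) :
    MeasurableSet {z : EuclideanSpace ℝ (Fin d) | r < ‖z‖} :=
  measurableSet_lt measurable_const measurable_norm

lemma gaussMeasure_norm_tail_of_two_le {d : ℕ} (hd : 2 ≤ d) {s : ℝ} (hs : 1 ≤ s) :
    gaussMeasure d (√d)⁻¹ {z | √d * s < ‖z‖} ≤ ENNReal.ofReal (Real.exp (-s ^ 2 / 10)) := by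
  have hd2 : (2 : ℝ) ≤ d := by exact_mod_cast hd
  have hd0 : (0 : ℝ) < d := by linarith
  refine (gaussMeasure_le_chernoff (by omega) (measurableSet_lt_norm d _) (b := d / 4)
    (K := -(d ^ 2 * s ^ 2 / 4)) (by positivity) fun v hv => ?_).trans
    (ENNReal.ofReal_le_ofReal ?_)
  · have h : d * s ^ 2 ≤ ‖v‖ ^ 2 := by
      have := pow_le_pow_left₀ (by positivity) (show √d * s ≤ ‖v‖ from le_of_lt hv) 2
      rwa [mul_pow, Real.sq_sqrt hd0.le] at this
    nlinarith
  · have h2 : (d : ℝ) / (2 * (d / 4)) = 2 := by field_simp; norm_num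
    rw [h2, Real.rpow_def_of_pos two_pos, ← Real.exp_add, Real.exp_le_exp]
    have hlog := Real.log_two_lt_d9
    have hs2 : 1 ≤ s ^ 2 := one_le_pow₀ hs
    have h1 : Real.log 2 * (d / 2) ≤ 0.35 * d := by nlinarith
    have h3 : 2 * d ≤ (d : ℝ) ^ 2 := by nlinarith
    have h4 : (d : ℝ) ^ 2 / 4 - 1 / 10 ≤ (d ^ 2 / 4 - 1 / 10) * s ^ 2 :=
      le_mul_of_one_le_right (by nlinarith) hs2
    linarith

lemma integral_norm_mul_exp_neg_mul_norm_sq {b : ℝ} (hb : 0 < b) :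
    ∫ v : EuclideanSpace ℝ (Fin 1), ‖v‖ * Real.exp (-b * ‖v‖ ^ 2) = 1 / b := by
  rw [integral_fun_norm_addHaar volume (fun r => r * Real.exp (-b * r ^ 2))]
  have h := integral_rpow_mul_exp_neg_mul_rpow (p := 2) (q := 1) two_pos (by norm_num) hb
  norm_num [Real.Gamma_one, Real.rpow_neg_one] at h
  have hΓ : √π / Real.Gamma (2⁻¹ + 1) = 2 := by
    rw [Real.Gamma_add_one (by norm_num), ← one_div, Real.Gamma_one_half_eq]
    field_simp
  simp [Measure.real, EuclideanSpace.volume_ball, h, hΓ]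
  ring

lemma gaussMeasure_norm_tail_one {s : ℝ} (hs : 1 ≤ s) :
    gaussMeasure 1 (√(1 : ℕ))⁻¹ {z | √(1 : ℕ) * s < ‖z‖} ≤
      ENNReal.ofReal (Real.exp (-s ^ 2 / 10)) := by
  have hI := integral_norm_mul_exp_neg_mul_norm_sq (b := 2 / 5) (by norm_num)
  refine (gaussMeasure_le_integral (measurableSet_lt_norm 1 _)
    (g := fun v => (√(2 * π))⁻¹ * Real.exp (-s ^ 2 / 10) * (‖v‖ * Real.exp (-(2 / 5) * ‖v‖ ^ 2)))
    ((Integrable.of_integral_ne_zero (by rw [hI]; norm_num)).const_mul _)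
    (fun v => by positivity) fun v hv => ?_).trans (ENNReal.ofReal_le_ofReal ?_)
  · have hv' : s < ‖v‖ := by simpa using hv
    have hexp : Real.exp (-(1 / 2) * ‖v‖ ^ 2) ≤
        Real.exp (-s ^ 2 / 10) * Real.exp (-(2 / 5) * ‖v‖ ^ 2) := by
      rw [← Real.exp_add, Real.exp_le_exp]
      nlinarith
    rw [gaussDensity_inv_sqrt le_rfl, Nat.cast_one, div_one, neg_div,
      Real.rpow_neg (by positivity), ← Real.sqrt_eq_rpow, mul_assoc]
    gcongr
    nlinarith [Real.exp_pos (-(1 / 2) * ‖v‖ ^ 2)]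
  · rw [integral_const_mul, hI]
    have h : 5 / 2 ≤ √(2 * π) := Real.le_sqrt_of_sq_le (by nlinarith [Real.pi_gt_d2])
    have h' : (√(2 * π))⁻¹ ≤ 2 / 5 := by
      rw [inv_le_comm₀ (by positivity) (by norm_num)]
      linarith
    nlinarith [Real.exp_pos (-s ^ 2 / 10)]

lemma gaussMeasure_norm_tail {d : ℕ} (hd : 1 ≤ d) {s : ℝ} (hs : 1 ≤ s) :
    gaussMeasure d (√d)⁻¹ {z | √d * s < ‖z‖} ≤ ENNReal.ofReal (Real.exp (-s ^ 2 / 10)) := by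
  rcases hd.eq_or_lt with rfl | hd
  · exact gaussMeasure_norm_tail_one hs
  · exact gaussMeasure_norm_tail_of_two_le hd hs

lemma one_le_ofReal_rpow_mul_rpow_neg {a t τ : ℝ} (ha : 0 < a) (hτ : 0 < τ) (hta : t ≤ a) :
    1 ≤ ENNReal.ofReal (a ^ τ) * ENNReal.ofReal t ^ (-τ) := by
  have ha0 : ENNReal.ofReal a ≠ 0 := (ENNReal.ofReal_pos.2 ha).ne'
  calc (1 : ENNReal) = ENNReal.ofReal (a ^ τ) * ENNReal.ofReal a ^ (-τ) := by
        rw [← ENNReal.ofReal_rpow_of_pos ha, ← ENNReal.rpow_add _ _ ha0 ENNReal.ofReal_ne_top]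
        simp
    _ ≤ _ := by
        simp only [ENNReal.rpow_neg]
        gcongr

lemma gaussMeasure_coneRadius_le {d : ℕ} (hd : 1 ≤ d) (ρ : ℝ) {τ lam q : ℝ} (hτ : 0 < τ)
    (hlam : lam ∈ Set.Ioo (0 : ℝ) 1) (hq : q ∈ Set.Ioo (0 : ℝ) 1) :
    gaussMeasure d (√d)⁻¹ {z | ρ / lam < ‖z‖} ≤
      ENNReal.ofReal (lam ^ (q * τ)) * ENNReal.ofReal (ρ / √d) ^ (-τ) +
        ENNReal.ofReal (Real.exp (-1 / (10 * lam ^ (2 * (1 - q))))) := by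
  have hd0 : (0 : ℝ) < √d := Real.sqrt_pos.2 (by exact_mod_cast hd)
  obtain ⟨hl0, hl1⟩ := hlam
  rcases le_total (ρ / √d) (lam ^ q) with h | h
  · rw [Real.rpow_mul hl0.le]
    exact (gaussMeasure_le_one hd).trans ((one_le_ofReal_rpow_mul_rpow_neg
      (Real.rpow_pos_of_pos hl0 q) hτ h).trans le_self_add)
  · have hs : 1 ≤ lam ^ (q - 1) :=
      Real.one_le_rpow_of_pos_of_le_one_of_nonpos hl0 hl1.le (by linarith [hq.2])
    have hsq : -(lam ^ (q - 1)) ^ 2 / 10 = -1 / (10 * lam ^ (2 * (1 - q))) := by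
      rw [← Real.rpow_natCast, ← Real.rpow_mul hl0.le,
        show (q - 1) * ((2 : ℕ) : ℝ) = -(2 * (1 - q)) by push_cast; ring, Real.rpow_neg hl0.le]
      field_simp
    have hsub : {z : EuclideanSpace ℝ (Fin d) | ρ / lam < ‖z‖} ⊆
        {z | √d * lam ^ (q - 1) < ‖z‖} := fun z hz => by
      refine lt_of_le_of_lt (b := ρ / lam) ?_ hz
      rw [Real.rpow_sub_one hl0.ne', ← mul_div_assoc]
      gcongr
      rwa [le_div_iff₀' hd0] at h
    rw [← hsq]
    exact (measure_mono hsub).trans ((gaussMeasure_norm_tail hd hs).trans le_add_self)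

/-- The set of admissible radii whose supremum is `coneRadius`. -/
def admissibleRadii {d : ℕ} (Y : Finset (EuclideanSpace ℝ (Fin d)))
    (θ : EuclideanSpace ℝ (Fin d)) : Set ℝ :=
  {r : ℝ | 0 < r ∧ ∀ u ∈ closedBall (0 : EuclideanSpace ℝ (Fin d)) 1,
    ∃ y ∈ Y, θ ∈ normalCone Y y ∧ θ + r • u ∈ normalCone Y y}

lemma isClosed_normalCone {d : ℕ} (Y : Finset (EuclideanSpace ℝ (Fin d)))
    (y : EuclideanSpace ℝ (Fin d)) : IsClosed (normalCone Y y) := by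
  simp only [normalCone, Set.ofPred_forall]
  exact isClosed_biInter fun y' _ => isClosed_le (by fun_prop) (by fun_prop)

lemma measurableSet_mem_admissibleRadii {d : ℕ} (Y : Finset (EuclideanSpace ℝ (Fin d)))
    (r : ℝ) : MeasurableSet {θ | r ∈ admissibleRadii Y θ} := by
  suffices h : IsClosed {θ | ∀ u ∈ closedBall (0 : EuclideanSpace ℝ (Fin d)) 1,
      ∃ y ∈ Y, θ ∈ normalCone Y y ∧ θ + r • u ∈ normalCone Y y} from
    (MeasurableSet.const (0 < r)).inter h.measurableSet
  simp only [Set.ofPred_forall]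
  refine isClosed_biInter fun u _ => ?_
  have h : {θ | ∃ y ∈ Y, θ ∈ normalCone Y y ∧ θ + r • u ∈ normalCone Y y} =
      ⋃ y ∈ Y, normalCone Y y ∩ (fun θ => θ + r • u) ⁻¹' normalCone Y y := by
    ext θ
    simp [and_left_comm]
  rw [h]
  exact Y.finite_toSet.isClosed_biUnion fun y _ =>
    (isClosed_normalCone Y y).inter ((isClosed_normalCone Y y).preimage (by fun_prop))

lemma admissibleRadii_of_le {d : ℕ} {Y : Finset (EuclideanSpace ℝ (Fin d))}
    {θ : EuclideanSpace ℝ (Fin d)} {r s : ℝ} (hr : r ∈ admissibleRadii Y θ) (hs : 0 < s)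
    (hsr : s ≤ r) : s ∈ admissibleRadii Y θ := by
  refine ⟨hs, fun u hu => ?_⟩
  have hr0 := hr.1
  have hmem : (s / r) • u ∈ closedBall (0 : EuclideanSpace ℝ (Fin d)) 1 := by
    rw [mem_closedBall_zero_iff] at hu ⊢
    rw [norm_smul, Real.norm_of_nonneg (by positivity)]
    exact mul_le_one₀ ((div_le_one hr0).2 hsr) (norm_nonneg _) hu
  simpa [smul_smul, mul_div_cancel₀ s hr0.ne'] using hr.2 _ hmem

lemma lt_coneRadius_iff {d : ℕ} (Y : Finset (EuclideanSpace ℝ (Fin d)))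
    (θ : EuclideanSpace ℝ (Fin d)) {a : ℝ} (ha : 0 ≤ a) :
    a < coneRadius Y θ ↔ (∃ n : ℕ, (n + 1 : ℝ) ∉ admissibleRadii Y θ) ∧
      ∃ p : ℚ, a < p ∧ (p : ℝ) ∈ admissibleRadii Y θ := by
  change a < sSup (admissibleRadii Y θ) ↔ _
  constructor
  · intro h
    have hne : (admissibleRadii Y θ).Nonempty := by
      by_contra hne
      rw [Set.not_nonempty_iff_eq_empty.1 hne, Real.sSup_empty] at h
      linarith
    constructor
    · by_contra! hall
      rw [Real.sSup_of_not_bddAbove] at h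
      · linarith
      · rintro ⟨b, hb⟩
        obtain ⟨n, hn⟩ := exists_nat_gt b
        linarith [hb (hall n)]
    · obtain ⟨r, hr, har⟩ := exists_lt_of_lt_csSup hne h
      obtain ⟨p, hap, hpr⟩ := exists_rat_btwn har
      exact ⟨p, hap, admissibleRadii_of_le hr (by linarith) hpr.le⟩
  · rintro ⟨⟨n, hn⟩, p, hap, hp⟩
    refine hap.trans_le (le_csSup ⟨n + 1, fun r hr => ?_⟩ hp)
    by_contra! hlt
    exact hn (admissibleRadii_of_le hr (by positivity) hlt.le)

lemma measurable_coneRadius {d : ℕ} (Y : Finset (EuclideanSpace ℝ (Fin d))) :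
    Measurable (coneRadius Y) := by
  refine measurable_of_Ioi fun a => ?_
  rcases lt_or_ge a 0 with ha | ha
  · convert MeasurableSet.univ
    exact Set.eq_univ_of_forall fun θ => ha.trans_le (Real.sSup_nonneg fun r hr => hr.1.le)
  · have h : coneRadius Y ⁻¹' Set.Ioi a =
        (⋃ n : ℕ, {θ | (n + 1 : ℝ) ∈ admissibleRadii Y θ}ᶜ) ∩
          ⋃ p : ℚ, {θ | a < p ∧ (p : ℝ) ∈ admissibleRadii Y θ} := by
      ext θ
      simp [lt_coneRadius_iff Y θ ha]
    rw [h]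
    exact (MeasurableSet.iUnion fun n => (measurableSet_mem_admissibleRadii Y _).compl).inter
      (MeasurableSet.iUnion fun p =>
        (MeasurableSet.const _).inter (measurableSet_mem_admissibleRadii Y _))

lemma integral_toReal_le_of_lintegral_le {α : Type*} [MeasurableSpace α] {μ : Measure α}
    {f : α → ENNReal} {B : ℝ} (hB : 0 ≤ B) (h : ∫⁻ x, f x ∂μ ≤ ENNReal.ofReal B) :
    ∫ x, (f x).toReal ∂μ ≤ B := by
  by_cases hf : AEStronglyMeasurable (fun x => (f x).toReal) μ
  · rw [integral_eq_lintegral_of_nonneg_ae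
      (Filter.Eventually.of_forall fun _ => ENNReal.toReal_nonneg) hf]
    exact ENNReal.toReal_le_of_le_ofReal hB
      ((lintegral_mono fun _ => ENNReal.ofReal_toReal_le).trans h)
  · rwa [integral_non_aestronglyMeasurable hf]

/-- Under the moment condition `E_X[(ρ(ψ_w(X))/√d)^{-τ}] ≤ C_τ`, the quantity
`V_w(λ) = E_X[P(‖Z‖ > ρ(ψ_w(X))/λ | X)]` (with `Z ~ N(0,(1/d)·I_d)` independent of `X`)
satisfies, for `λ, q ∈ (0,1)`, `V_w(λ) ≤ C_τ·λ^{qτ} + exp(−1/(10·λ^{2(1−q)}))`. -/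
theorem statement14 {d : ℕ} (hd : 1 ≤ d) (Y : Finset (EuclideanSpace ℝ (Fin d)))
    (hY : Y.Nonempty)
    {𝒳 : Type*} [MeasurableSpace 𝒳] (μ : Measure 𝒳) [IsProbabilityMeasure μ]
    (ψ : 𝒳 → EuclideanSpace ℝ (Fin d)) (hψ : Measurable ψ)
    (τ C : ℝ) (hτ : 0 < τ)
    (hmom : (∫⁻ x, (ENNReal.ofReal (coneRadius Y (ψ x) / Real.sqrt d)) ^ (-τ) ∂μ) ≤
      ENNReal.ofReal C)
    (lam q : ℝ) (hlam : lam ∈ Set.Ioo (0 : ℝ) 1) (hq : q ∈ Set.Ioo (0 : ℝ) 1) :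
    (∫ x, (gaussMeasure d (Real.sqrt d)⁻¹
        {z | coneRadius Y (ψ x) / lam < ‖z‖}).toReal ∂μ) ≤
      C * lam ^ (q * τ) + Real.exp (-1 / (10 * lam ^ (2 * (1 - q)))) := by
  have hC : 0 ≤ C := by
    by_contra hneg
    rw [ENNReal.ofReal_of_nonpos (not_le.1 hneg).le, nonpos_iff_eq_zero] at hmom
    have hmeas : Measurable fun x => ENNReal.ofReal (coneRadius Y (ψ x) / √d) ^ (-τ) :=
      ((((measurable_coneRadius Y).comp hψ).div_const _).ennreal_ofReal).pow_const _
    obtain ⟨x, hx⟩ := ((lintegral_eq_zero_iff hmeas).1 hmom).exists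
    simp [ENNReal.rpow_eq_zero_iff, hτ.not_gt] at hx
  have hlam0 : 0 ≤ lam ^ (q * τ) := Real.rpow_nonneg hlam.1.le _
  refine integral_toReal_le_of_lintegral_le (by positivity) ?_
  refine (lintegral_mono fun x =>
    gaussMeasure_coneRadius_le hd (coneRadius Y (ψ x)) hτ hlam hq).trans ?_
  rw [lintegral_add_right _ measurable_const, lintegral_const_mul' _ _ ENNReal.ofReal_ne_top,
    lintegral_const, measure_univ, mul_one, ENNReal.ofReal_add (by positivity) (by positivity),
    mul_comm C, ENNReal.ofReal_mul hlam0]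
  gcongr
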